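/- arXiv:math/0506610 — 7 statements merged into one kernel-verified Lean document; each statement's English description precedes it below -/
import Mathlib

section
/- Let η = exp(2πi/15) ∈ ℂ (a primitive 15th root of unity) and let m₁, m₂, m₃, m₄, m₁₁, m₁₂ be nonnegative integers satisfying, as complex numbers, 0 = −(1 + η⁻⁵) + Σ_{i ∈ {1,2,3,4,11,12}} mᵢ / ((1 − η⁻ⁱ)(1 − η^{5+i})), together with m₁ + m₂ + m₃ + m₄ + m₁₁ + m₁₂ ≤ 4. Then (m₁, m₂, m₃, m₄, m₁₁, m₁₂) = (1, 0, 1, 1, 0, 1); in particular the sum of the mᵢ equals 4. -/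
open Polynomial in
/-- The powers of a primitive `n`-th root of unity below `φ n` are linearly independent over `ℚ`. -/
lemma IsPrimitiveRoot.linearIndependent_pow_rat {K : Type*} [Field K] [CharZero K] {n : ℕ} {ζ : K}
    (hζ : IsPrimitiveRoot ζ n) (hn : 0 < n) :
    LinearIndependent ℚ fun i : Fin n.totient ↦ ζ ^ (i : ℕ) := by
  have hdeg : (minpoly ℚ ζ).natDegree = n.totient := by
    rw [← cyclotomic_eq_minpoly_rat hζ hn, natDegree_cyclotomic]
  rw [← hdeg]
  exact linearIndependent_pow ζ

lemma IsPrimitiveRoot.cyclotomic_fifteen_eq_zero {K : Type*} [Field K] {η : K}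
    (hη : IsPrimitiveRoot η 15) :
    η ^ 8 - η ^ 7 + η ^ 5 - η ^ 4 + η ^ 3 - η + 1 = 0 := by
  have h3 : η ^ 5 - 1 ≠ 0 := sub_ne_zero.2 (hη.pow_ne_one_of_pos_of_lt (by norm_num) (by norm_num))
  have h5 : η ^ 3 - 1 ≠ 0 := sub_ne_zero.2 (hη.pow_ne_one_of_pos_of_lt (by norm_num) (by norm_num))
  have h15 : η ^ 15 = 1 := hη.pow_eq_one
  have hfive : η ^ 10 + η ^ 5 + 1 = 0 :=
    (mul_eq_zero.1 (by linear_combination h15 :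
      (η ^ 5 - 1) * (η ^ 10 + η ^ 5 + 1) = 0)).resolve_left h3
  have hmul : (η ^ 2 + η + 1) * (η ^ 8 - η ^ 7 + η ^ 5 - η ^ 4 + η ^ 3 - η + 1) = 0 := by
    linear_combination hfive
  refine (mul_eq_zero.1 hmul).resolve_left fun h ↦ h5 ?_
  linear_combination (η - 1) * h

lemma IsPrimitiveRoot.eq_zero_of_sum_eq_zero_fifteen {K : Type*} [Field K] [CharZero K] {η : K}
    (hη : IsPrimitiveRoot η 15) (c : Fin 8 → ℤ) (h : ∑ i, (c i : K) * η ^ (i : ℕ) = 0)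
    (i : Fin 8) : c i = 0 := by
  have hli : LinearIndependent ℚ fun i : Fin 8 ↦ η ^ (i : ℕ) :=
    hη.linearIndependent_pow_rat (by norm_num)
  have hc := Fintype.linearIndependent_iff.1 hli (fun i ↦ (c i : ℚ))
    (by simpa [Algebra.smul_def] using h) i
  exact_mod_cast hc

/-- Holomorphic Lefschetz constraint for an order-15 automorphism `g` of a K3
surface with `g*ω_X = η⁵ ω_X`, where `η = exp(2πi/15)`: the point counts are
forced to be `(m₁, m₂, m₃, m₄, m₁₁, m₁₂) = (1, 0, 1, 1, 0, 1)`. -/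
theorem stmt_2 (η : ℂ) (hη : η = Complex.exp (2 * Real.pi * Complex.I / 15))
    (m₁ m₂ m₃ m₄ m₁₁ m₁₂ : ℕ)
    (h : (0 : ℂ) = -(1 + η ^ (-5 : ℤ))
        + (m₁ : ℂ) / ((1 - η ^ (-1 : ℤ)) * (1 - η ^ (6 : ℕ)))
        + (m₂ : ℂ) / ((1 - η ^ (-2 : ℤ)) * (1 - η ^ (7 : ℕ)))
        + (m₃ : ℂ) / ((1 - η ^ (-3 : ℤ)) * (1 - η ^ (8 : ℕ)))
        + (m₄ : ℂ) / ((1 - η ^ (-4 : ℤ)) * (1 - η ^ (9 : ℕ)))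
        + (m₁₁ : ℂ) / ((1 - η ^ (-11 : ℤ)) * (1 - η ^ (16 : ℕ)))
        + (m₁₂ : ℂ) / ((1 - η ^ (-12 : ℤ)) * (1 - η ^ (17 : ℕ))))
    (hsum : m₁ + m₂ + m₃ + m₄ + m₁₁ + m₁₂ ≤ 4) :
    m₁ = 1 ∧ m₂ = 0 ∧ m₃ = 1 ∧ m₄ = 1 ∧ m₁₁ = 0 ∧ m₁₂ = 1 ∧
      m₁ + m₂ + m₃ + m₄ + m₁₁ + m₁₂ = 4 := by
  have hprim : IsPrimitiveRoot η 15 := by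
    rw [hη]
    exact_mod_cast Complex.isPrimitiveRoot_exp 15 (by norm_num)
  have h15 : η ^ 15 = 1 := hprim.pow_eq_one
  have hΦ := hprim.cyclotomic_fifteen_eq_zero
  have hinv (a b : ℕ) (hab : a + b = 15) : η ^ (-(a : ℤ)) = η ^ b := by
    rw [zpow_neg, zpow_natCast]
    exact inv_eq_of_mul_eq_one_right (by rw [← pow_add, hab, h15])
  have hdiv {m d p : ℂ} (hd : d * p = 5) : m / d = m * p / 5 := by
    have hd0 : d ≠ 0 := by
      rintro rfl
      norm_num at hd
    rw [div_eq_div_iff hd0 (by norm_num)]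
    linear_combination -m * hd
  have e5 : η ^ (-5 : ℤ) = η ^ 10 := hinv 5 10 rfl
  have e1 : η ^ (-1 : ℤ) = η ^ 14 := hinv 1 14 rfl
  have e2 : η ^ (-2 : ℤ) = η ^ 13 := hinv 2 13 rfl
  have e3 : η ^ (-3 : ℤ) = η ^ 12 := hinv 3 12 rfl
  have e4 : η ^ (-4 : ℤ) = η ^ 11 := hinv 4 11 rfl
  have e11 : η ^ (-11 : ℤ) = η ^ 4 := hinv 11 4 rfl
  have e12 : η ^ (-12 : ℤ) = η ^ 3 := hinv 12 3 rfl
  have d1 : (1 - η ^ 14) * (1 - η ^ 6) *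
      (4 - 4 * η - 4 * η ^ 2 + 2 * η ^ 3 - 3 * η ^ 4 + η ^ 5 + η ^ 6 - 6 * η ^ 7) = 5 := by
    clear * - hΦ
    grind
  have d2 : (1 - η ^ 13) * (1 - η ^ 7) *
      (5 - 5 * η - 5 * η ^ 2 + 5 * η ^ 3 - 5 * η ^ 4 + 5 * η ^ 5 - 5 * η ^ 7) = 5 := by
    clear * - hΦ
    grind
  have d3 : (1 - η ^ 12) * (1 - η ^ 8) *
      (-3 + 3 * η + 3 * η ^ 2 - 4 * η ^ 3 + η ^ 4 - 2 * η ^ 5 - 2 * η ^ 6 + 2 * η ^ 7) = 5 := by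
    clear * - hΦ
    grind
  have d4 : (1 - η ^ 11) * (1 - η ^ 9) *
      (1 - η - η ^ 2 + 3 * η ^ 3 - 2 * η ^ 4 - η ^ 5 - η ^ 6 + η ^ 7) = 5 := by
    clear * - hΦ
    grind
  have d11 : (1 - η ^ 4) * (1 - η ^ 16) *
      (-5 + 5 * η + 5 * η ^ 2 - 5 * η ^ 3 + 5 * η ^ 4 + 5 * η ^ 7) = 5 := by
    clear * - hΦ
    grind
  have d12 : (1 - η ^ 3) * (1 - η ^ 17) *
      (-2 + 2 * η + 2 * η ^ 2 - η ^ 3 + 4 * η ^ 4 - 3 * η ^ 5 + 2 * η ^ 6 + 3 * η ^ 7) = 5 := by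
    clear * - hΦ
    grind
  rw [e5, e1, e2, e3, e4, e11, e12,
    hdiv d1, hdiv d2, hdiv d3, hdiv d4, hdiv d11, hdiv d12] at h
  have key := hprim.eq_zero_of_sum_eq_zero_fifteen
    ![4 * m₁ + 5 * m₂ - 3 * m₃ + m₄ - 5 * m₁₁ - 2 * m₁₂,
      -4 * m₁ - 5 * m₂ + 3 * m₃ - m₄ + 5 * m₁₁ + 2 * m₁₂,
      -4 * m₁ - 5 * m₂ + 3 * m₃ - m₄ + 5 * m₁₁ + 2 * m₁₂,
      2 * m₁ + 5 * m₂ - 4 * m₃ + 3 * m₄ - 5 * m₁₁ - m₁₂,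
      -3 * m₁ - 5 * m₂ + m₃ - 2 * m₄ + 5 * m₁₁ + 4 * m₁₂,
      m₁ + 5 * m₂ - 2 * m₃ - m₄ - 3 * m₁₂ + 5,
      m₁ - 2 * m₃ - m₄ + 2 * m₁₂,
      -6 * m₁ - 5 * m₂ + 2 * m₃ + m₄ + 5 * m₁₁ + 3 * m₁₂] (by
      simp only [Fin.sum_univ_eight, Matrix.cons_val]
      push_cast
      norm_num
      linear_combination -5 * h + 5 * (η ^ 2 + η + 1) * hΦ)
  simp only [Fin.forall_fin_succ] at key
  simp at key
  omega
end

section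
/- Let η = exp(2πi/20) ∈ ℂ (a primitive 20th root of unity) and let m₁, m₂, m₃, m₄, m₆, m₇, m₁₆, m₁₇ be nonnegative integers satisfying, as complex numbers, 0 = −(1 + η⁻⁵) + Σ_{i ∈ {1,2,3,4,6,7,16,17}} mᵢ / ((1 − η⁻ⁱ)(1 − η^{5+i})), together with m₁ + m₂ + m₃ + m₄ + m₆ + m₇ + m₁₆ + m₁₇ ≤ 4. Then (m₁, m₂, m₃, m₄, m₆, m₇, m₁₆, m₁₇) = (1, 1, 0, 0, 1, 0, 0, 1); in particular the sum of the mᵢ equals 4. -/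
open Polynomial in
/-- The powers `η ^ k`, `k < φ(n)`, of a primitive `n`-th root of unity are linearly independent
over `ℚ`. -/
theorem IsPrimitiveRoot.eq_zero_of_sum_range_totient {n : ℕ} (hn : 0 < n) {η : ℂ}
    (hη : IsPrimitiveRoot η n) (a : ℕ → ℚ)
    (h : ∑ k ∈ Finset.range n.totient, (a k : ℂ) * η ^ k = 0) :
    ∀ k < n.totient, a k = 0 := by
  have hdeg : (minpoly ℚ η).natDegree = n.totient := by
    rw [← cyclotomic_eq_minpoly_rat hη hn, natDegree_cyclotomic]
  have hli := Fintype.linearIndependent_iff.mp (linearIndependent_pow (K := ℚ) η)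
    (fun i ↦ a i) (by
      rw [Fin.sum_univ_eq_sum_range (fun k ↦ a k • η ^ k), hdeg]
      simpa only [Rat.smul_def] using h)
  intro k hk
  exact hli ⟨k, hdeg ▸ hk⟩

theorem div_eq_mul_of_mul_eq_one {K : Type*} [Field K] {d p : K} (h : d * p = 1) (m : K) :
    m / d = m * p := by
  rw [div_eq_mul_inv, inv_eq_of_mul_eq_one_right h]

/-- Holomorphic Lefschetz constraint for an order-20 automorphism `g` of a K3
surface with `g*ω_X = η⁵ ω_X`, where `η = exp(2πi/20)`: the point counts are
forced to be `(m₁, m₂, m₃, m₄, m₆, m₇, m₁₆, m₁₇) = (1, 1, 0, 0, 1, 0, 0, 1)`. -/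
theorem stmt_3 (η : ℂ) (hη : η = Complex.exp (2 * Real.pi * Complex.I / 20))
    (m₁ m₂ m₃ m₄ m₆ m₇ m₁₆ m₁₇ : ℕ)
    (h : (0 : ℂ) = -(1 + η ^ (-5 : ℤ))
        + (m₁ : ℂ) / ((1 - η ^ (-1 : ℤ)) * (1 - η ^ (6 : ℕ)))
        + (m₂ : ℂ) / ((1 - η ^ (-2 : ℤ)) * (1 - η ^ (7 : ℕ)))
        + (m₃ : ℂ) / ((1 - η ^ (-3 : ℤ)) * (1 - η ^ (8 : ℕ)))
        + (m₄ : ℂ) / ((1 - η ^ (-4 : ℤ)) * (1 - η ^ (9 : ℕ)))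
        + (m₆ : ℂ) / ((1 - η ^ (-6 : ℤ)) * (1 - η ^ (11 : ℕ)))
        + (m₇ : ℂ) / ((1 - η ^ (-7 : ℤ)) * (1 - η ^ (12 : ℕ)))
        + (m₁₆ : ℂ) / ((1 - η ^ (-16 : ℤ)) * (1 - η ^ (21 : ℕ)))
        + (m₁₇ : ℂ) / ((1 - η ^ (-17 : ℤ)) * (1 - η ^ (22 : ℕ))))
    (hsum : m₁ + m₂ + m₃ + m₄ + m₆ + m₇ + m₁₆ + m₁₇ ≤ 4) :
    m₁ = 1 ∧ m₂ = 1 ∧ m₃ = 0 ∧ m₄ = 0 ∧ m₆ = 1 ∧ m₇ = 0 ∧ m₁₆ = 0 ∧ m₁₇ = 1 ∧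
      m₁ + m₂ + m₃ + m₄ + m₆ + m₇ + m₁₆ + m₁₇ = 4 := by
  have hprim : IsPrimitiveRoot η 20 := by
    rw [hη]
    exact_mod_cast Complex.isPrimitiveRoot_exp 20 (by norm_num)
  have h20 : η ^ 20 = 1 := hprim.pow_eq_one
  have hΦ : η ^ 8 - η ^ 6 + η ^ 4 - η ^ 2 + 1 = 0 := by
    have h4 : η ^ 4 - 1 ≠ 0 :=
      sub_ne_zero.mpr (hprim.pow_ne_one_of_pos_of_lt (by norm_num) (by norm_num))
    have h10 : η ^ 10 - 1 ≠ 0 :=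
      sub_ne_zero.mpr (hprim.pow_ne_one_of_pos_of_lt (by norm_num) (by norm_num))
    have h10' : η ^ 10 + 1 = 0 := (mul_eq_zero.mp (by linear_combination h20 :
      (η ^ 10 - 1) * (η ^ 10 + 1) = 0)).resolve_left h10
    refine (mul_eq_zero.mp ?_).resolve_left h4
    linear_combination (η ^ 2 - 1) * h10'
  have hz (i : ℤ) (k : ℕ) (hik : k = -i + 20) : η ^ (-i) = η ^ k := by
    rw [← zpow_natCast, hik, zpow_add₀ (hprim.ne_zero (by norm_num))]
    exact_mod_cast (by rw [h20, mul_one] : η ^ (-i) = η ^ (-i) * η ^ 20)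
  have e0 : η ^ (-5 : ℤ) = -η ^ 5 := by
    rw [hz 5 15 rfl]
    clear * - hΦ
    grind
  have e₁ : (m₁ : ℂ) / ((1 - η ^ (-1 : ℤ)) * (1 - η ^ (6 : ℕ))) =
      m₁ * (1 - η ^ 2 + η ^ 4 - η ^ 6 - η ^ 7) := by
    rw [hz 1 19 rfl]
    refine div_eq_mul_of_mul_eq_one ?_ _
    clear * - hΦ
    grind
  have e₂ : (m₂ : ℂ) / ((1 - η ^ (-2 : ℤ)) * (1 - η ^ (7 : ℕ))) =
      m₂ * (η - η ^ 4) := by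
    rw [hz 2 18 rfl]
    refine div_eq_mul_of_mul_eq_one ?_ _
    clear * - hΦ
    grind
  have e₃ : (m₃ : ℂ) / ((1 - η ^ (-3 : ℤ)) * (1 - η ^ (8 : ℕ))) =
      m₃ * (-2/5 + 3/5 * η + 4/5 * η ^ 2 - 6/5 * η ^ 3 - 1/5 * η ^ 4
        + 4/5 * η ^ 5 - 2/5 * η ^ 6 - 2/5 * η ^ 7) := by
    rw [hz 3 17 rfl]
    refine div_eq_mul_of_mul_eq_one ?_ _
    clear * - hΦ
    grind
  have e₄ : (m₄ : ℂ) / ((1 - η ^ (-4 : ℤ)) * (1 - η ^ (9 : ℕ))) =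
      m₄ * (-1/5 + 4/5 * η - 3/5 * η ^ 2 + 2/5 * η ^ 3 - 3/5 * η ^ 4
        + 2/5 * η ^ 5 - 1/5 * η ^ 6 - 1/5 * η ^ 7) := by
    rw [hz 4 16 rfl]
    refine div_eq_mul_of_mul_eq_one ?_ _
    clear * - hΦ
    grind
  have e₆ : (m₆ : ℂ) / ((1 - η ^ (-6 : ℤ)) * (1 - η ^ (11 : ℕ))) =
      m₆ * (η ^ 2 - η ^ 3) := by
    rw [hz 6 14 rfl]
    refine div_eq_mul_of_mul_eq_one ?_ _
    clear * - hΦ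
    grind
  have e₇ : (m₇ : ℂ) / ((1 - η ^ (-7 : ℤ)) * (1 - η ^ (12 : ℕ))) =
      m₇ * (2/5 - 3/5 * η - 4/5 * η ^ 2 + 1/5 * η ^ 3 + 6/5 * η ^ 4
        + 1/5 * η ^ 5 - 3/5 * η ^ 6 - 3/5 * η ^ 7) := by
    rw [hz 7 13 rfl]
    refine div_eq_mul_of_mul_eq_one ?_ _
    clear * - hΦ
    grind
  have e₁₆ : (m₁₆ : ℂ) / ((1 - η ^ (-16 : ℤ)) * (1 - η ^ (21 : ℕ))) =
      m₁₆ * (-4/5 - 4/5 * η + 3/5 * η ^ 2 + 3/5 * η ^ 3 - 2/5 * η ^ 4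
        - 2/5 * η ^ 5 + 6/5 * η ^ 6 + 6/5 * η ^ 7) := by
    rw [hz 16 4 rfl]
    refine div_eq_mul_of_mul_eq_one ?_ _
    clear * - hΦ
    grind
  have e₁₇ : (m₁₇ : ℂ) / ((1 - η ^ (-17 : ℤ)) * (1 - η ^ (22 : ℕ))) =
      m₁₇ * (-η + η ^ 3 - η ^ 5 + η ^ 6 + η ^ 7) := by
    rw [hz 17 3 rfl]
    refine div_eq_mul_of_mul_eq_one ?_ _
    clear * - hΦ
    grind
  rw [e0, e₁, e₂, e₃, e₄, e₆, e₇, e₁₆, e₁₇] at h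
  have hcoeff := hprim.eq_zero_of_sum_range_totient (by norm_num)
    (fun k ↦ ((![
      -5 + 5 * m₁ - 2 * m₃ - m₄ + 2 * m₇ - 4 * m₁₆,
      5 * m₂ + 3 * m₃ + 4 * m₄ - 3 * m₇ - 4 * m₁₆ - 5 * m₁₇,
      -5 * m₁ + 4 * m₃ - 3 * m₄ + 5 * m₆ - 4 * m₇ + 3 * m₁₆,
      -6 * m₃ + 2 * m₄ - 5 * m₆ + m₇ + 3 * m₁₆ + 5 * m₁₇,
      5 * m₁ - 5 * m₂ - m₃ - 3 * m₄ + 6 * m₇ - 2 * m₁₆,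
      5 + 4 * m₃ + 2 * m₄ + m₇ - 2 * m₁₆ - 5 * m₁₇,
      -5 * m₁ - 2 * m₃ - m₄ - 3 * m₇ + 6 * m₁₆ + 5 * m₁₇,
      -5 * m₁ - 2 * m₃ - m₄ - 3 * m₇ + 6 * m₁₆ + 5 * m₁₇] : Fin 8 → ℤ) (Fin.ofNat 8 k) : ℚ)) (by
      rw [show Nat.totient 20 = 8 by decide]
      simp [Finset.sum_range_succ, Fin.ofNat]
      linear_combination -5 * h)
  rw [show Nat.totient 20 = 8 by decide] at hcoeff
  have c (k : Fin 8) := Int.cast_eq_zero.mp (hcoeff k k.2)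
  have c0 := c 0
  have c1 := c 1
  have c2 := c 2
  have c3 := c 3
  have c4 := c 4
  have c5 := c 5
  have c6 := c 6
  have c7 := c 7
  simp [Fin.ofNat] at c0 c1 c2 c3 c4 c5 c6 c7
  omega
end

section
/- Let G be a finite group and N a normal subgroup of G such that N is isomorphic (as a group) to the alternating group A₅ on 5 letters, and such that the quotient group G/N is cyclic of even order I. Then the extension splits: there exists a subgroup H of G with H ∩ N trivial and N·H = G (i.e. H is a complement of N in G), and H is cyclic of order I. -/
open Equiv MulAction

universe u

/-- A Klein four-subgroup of `A₅`, fixing the point `4`. -/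
def alternatingGroup.kleinFourFive : Subgroup (alternatingGroup (Fin 5)) where
  carrier := {g | (g : Perm (Fin 5)) = 1 ∨ (g : Perm (Fin 5)) = swap 0 1 * swap 2 3 ∨
    (g : Perm (Fin 5)) = swap 0 2 * swap 1 3 ∨ (g : Perm (Fin 5)) = swap 0 3 * swap 1 2}
  one_mem' := Or.inl rfl
  mul_mem' := by
    rintro ⟨a, _⟩ ⟨b, _⟩ (h | h | h | h) (k | k | k | k) <;>
      · simp only at h k
        subst h k
        simp only [Set.mem_ofPred_eq, MulMemClass.mk_mul_mk]
        decide
  inv_mem' := by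
    rintro ⟨a, _⟩ (h | h | h | h) <;>
      · simp only at h
        subst h
        simp only [Set.mem_ofPred_eq, InvMemClass.coe_inv]
        decide

theorem alternatingGroup.mem_kleinFourFive {g : alternatingGroup (Fin 5)} :
    g ∈ kleinFourFive ↔ (g : Perm (Fin 5)) = 1 ∨ (g : Perm (Fin 5)) = swap 0 1 * swap 2 3 ∨
      (g : Perm (Fin 5)) = swap 0 2 * swap 1 3 ∨ (g : Perm (Fin 5)) = swap 0 3 * swap 1 2 :=
  Iff.rfl

theorem alternatingGroup.card_kleinFourFive : Nat.card kleinFourFive = 4 := by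
  have h : (kleinFourFive.map (alternatingGroup (Fin 5)).subtype : Set (Perm (Fin 5))) =
      (({1, swap 0 1 * swap 2 3, swap 0 2 * swap 1 3, swap 0 3 * swap 1 2} :
        Finset (Perm (Fin 5))) : Set (Perm (Fin 5))) := by
    ext g
    simp only [Subgroup.coe_map, Subgroup.coe_subtype, Set.mem_image, SetLike.mem_coe,
      mem_kleinFourFive, Finset.coe_insert, Finset.coe_singleton, Set.mem_insert_iff,
      Set.mem_singleton_iff, Subtype.exists, exists_and_right, exists_eq_right]
    refine ⟨fun ⟨_, h⟩ ↦ h, fun h ↦ ⟨?_, h⟩⟩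
    rcases h with h | h | h | h <;> subst h <;> exact Perm.mem_alternatingGroup.2 (by decide)
  rw [← Subgroup.card_map_of_injective (alternatingGroup (Fin 5)).subtype_injective,
    ← SetLike.coe_sort_coe, h, Nat.card_coe_set_eq, Set.ncard_coe_finset]
  decide

theorem alternatingGroup.card_five : Nat.card (alternatingGroup (Fin 5)) = 60 := by
  rw [nat_card_alternatingGroup, Nat.card_fin]
  rfl

/-- The normalizer of `kleinFourFive` contains a `3`-cycle, so its order is divisible by `12`. -/
theorem alternatingGroup.card_sylow_two_five_le :
    Nat.card (Sylow 2 (alternatingGroup (Fin 5))) ≤ 5 := by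
  have hfac : Nat.factorization 60 2 = 2 := by
    rw [show 60 = 2 ^ 2 * 15 by rfl, Nat.factorization_mul (by norm_num) (by norm_num),
      Nat.prime_two.factorization_pow]
    simp [Nat.factorization_eq_zero_of_not_dvd]
  let P : Sylow 2 (alternatingGroup (Fin 5)) :=
    Sylow.ofCard kleinFourFive (by rw [card_kleinFourFive, card_five, hfac]; rfl)
  rw [Sylow.card_eq_index_normalizer P]
  let c : alternatingGroup (Fin 5) := ⟨swap 0 1 * swap 1 2, Perm.mem_alternatingGroup.2 (by decide)⟩
  have hc : c ∈ Subgroup.normalizer (kleinFourFive : Set (alternatingGroup (Fin 5))) := by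
    refine Subgroup.mem_normalizer_fintype ?_
    rintro ⟨a, _⟩ (h | h | h | h) <;>
      · simp only at h
        subst h
        rw [SetLike.mem_coe, mem_kleinFourFive]
        simp only [c, Subgroup.coe_mul, InvMemClass.coe_inv]
        decide
  have hc3 : orderOf c = 3 := orderOf_eq_prime (by decide) (by decide)
  have h3 : 3 ∣ Nat.card (Subgroup.normalizer (kleinFourFive : Set (alternatingGroup (Fin 5)))) :=
    hc3 ▸ Subgroup.orderOf_dvd_natCard _ hc
  have h4 : 4 ∣ Nat.card (Subgroup.normalizer (kleinFourFive : Set (alternatingGroup (Fin 5)))) :=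
    card_kleinFourFive ▸ Subgroup.card_dvd_of_le Subgroup.le_normalizer
  have h12 := Nat.Coprime.mul_dvd_of_dvd_of_dvd (by norm_num) h3 h4
  have hmul := Subgroup.card_mul_index
    (Subgroup.normalizer (kleinFourFive : Set (alternatingGroup (Fin 5))))
  rw [card_five] at hmul
  change (Subgroup.normalizer (kleinFourFive : Set (alternatingGroup (Fin 5)))).index ≤ 5
  obtain ⟨k, hk⟩ := h12
  rw [hk] at hmul
  have : k ≠ 0 := by rintro rfl; simp at hmul
  nlinarith [Nat.pos_of_ne_zero this]

/-- A simple group acts faithfully on its Sylow `p`-subgroups unless it is a `p`-group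
or has order prime to `p`. -/
theorem Sylow.toPermHom_injective_of_isSimpleGroup {N : Type*} [Group N] [Finite N]
    [IsSimpleGroup N] {p : ℕ} [Fact p.Prime] (P : Sylow p N)
    (hbot : (P : Subgroup N) ≠ ⊥) (htop : (P : Subgroup N) ≠ ⊤) :
    Function.Injective (toPermHom N (Sylow p N)) := by
  rw [← MonoidHom.ker_eq_bot_iff]
  refine (MonoidHom.normal_ker _).eq_bot_or_eq_top.resolve_right fun hker ↦ ?_
  have hP : (P : Subgroup N).Normal := by
    rw [← Subgroup.normalizer_eq_top_iff, eq_top_iff]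
    intro g _
    have hg : g ∈ (toPermHom N (Sylow p N)).ker := hker ▸ Subgroup.mem_top g
    exact Sylow.smul_eq_iff_mem_normalizer.1 (Perm.congr_fun (MonoidHom.mem_ker.1 hg) P)
  exact hP.eq_bot_or_eq_top.elim hbot htop

/-- Any permutation can be multiplied by an even one to give an involution or the identity. -/
theorem Equiv.Perm.exists_mul_alternatingGroup_sq_eq_one {α : Type*} [Fintype α] [DecidableEq α]
    (σ : Perm α) : ∃ τ ∈ alternatingGroup α, (σ * τ) ^ 2 = 1 := by
  rcases Int.units_eq_one_or (sign σ) with h | h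
  · exact ⟨σ⁻¹, by simpa [mem_alternatingGroup] using h, by simp⟩
  · cases subsingleton_or_nontrivial α
    · exact ⟨1, one_mem _, Subsingleton.elim _ _⟩
    · obtain ⟨a, b, hab⟩ := exists_pair_ne α
      refine ⟨σ⁻¹ * swap a b, ?_, by simp [sq]⟩
      simp [mem_alternatingGroup, h, sign_swap hab]

/-- If `g` generates `G` modulo `N` and `g` to the power `|G / N|` is trivial,
then `⟨g⟩` is a complement of `N`. -/
theorem Subgroup.isComplement'_zpowers_of_pow_eq_one {G : Type*} [Group G] [Finite G]
    (N : Subgroup G) [N.Normal] (g : G) (hgen : zpowers (g : G ⧸ N) = ⊤)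
    (hg : g ^ Nat.card (G ⧸ N) = 1) :
    IsComplement' N (zpowers g) ∧ Nat.card (zpowers g) = Nat.card (G ⧸ N) := by
  have hq : orderOf (g : G ⧸ N) = Nat.card (G ⧸ N) := by
    rw [← Nat.card_zpowers, hgen, card_top]
  have ho : orderOf g = Nat.card (G ⧸ N) :=
    (orderOf_dvd_of_pow_eq_one hg).antisymm (hq ▸ orderOf_map_dvd (QuotientGroup.mk' N) g)
  have hc : Nat.card (zpowers g) = Nat.card (G ⧸ N) := by rw [Nat.card_zpowers, ho]
  refine ⟨isComplement'_of_card_mul_and_disjoint ?_ ?_, hc⟩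
  · rw [hc, mul_comm, ← card_eq_card_quotient_mul_card_subgroup]
  · rw [disjoint_iff, eq_bot_iff]
    rintro x ⟨hxN, k, rfl⟩
    have : (g : G ⧸ N) ^ k = 1 := by
      rw [← QuotientGroup.mk_zpow]
      exact (QuotientGroup.eq_one_iff _).2 hxN
    rw [mem_bot]
    change g ^ k = 1
    rw [← orderOf_dvd_iff_zpow_eq_one] at this ⊢
    rwa [ho, ← hq]

/-- Conjugation on the Sylow `2`-subgroups of a normal subgroup `N ≅ A₅` is a homomorphism to
a symmetric group, injective on `N`, that maps `N` onto the alternating group. -/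
theorem exists_monoidHom_perm_map_eq_alternatingGroup {G : Type u} [Group G] (N : Subgroup G)
    [N.Normal] (e : N ≃* alternatingGroup (Fin 5)) :
    ∃ (α : Type u) (_ : Fintype α) (_ : DecidableEq α) (f : G →* Perm α),
      (∀ n ∈ N, f n = 1 → n = 1) ∧ N.map f = alternatingGroup α := by
  classical
  have : Finite N := .of_equiv _ e.symm.toEquiv
  have : IsSimpleGroup N := e.isSimpleGroup
  have hcardN : Nat.card N = 60 := (Nat.card_congr e.toEquiv).trans alternatingGroup.card_five
  let _ : Fintype (Sylow 2 N) := .ofFinite _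
  have hle : Nat.card (Sylow 2 N) ≤ 5 :=
    (Nat.card_le_card_of_surjective _
      (Sylow.mapSurjective_surjective (f := (e.symm : alternatingGroup (Fin 5) →* N))
        e.symm.surjective 2)).trans alternatingGroup.card_sylow_two_five_le
  let φ : G →* Perm (Sylow 2 N) := (toPermHom (MulAut N) (Sylow 2 N)).comp MulAut.conjNormal
  have hφ : φ.comp N.subtype = toPermHom N (Sylow 2 N) := by
    ext1 n
    simp only [φ, MonoidHom.comp_apply, Subgroup.coe_subtype, MulAut.conjNormal_val]
    ext P : 1
    exact Sylow.smul_def.symm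
  obtain ⟨P⟩ := (inferInstance : Nonempty (Sylow 2 N))
  have hinj : Function.Injective (φ.comp N.subtype) := by
    rw [hφ]
    refine P.toPermHom_injective_of_isSimpleGroup (P.ne_bot_of_dvd_card ?_) fun htop ↦ ?_
    · rw [hcardN]; norm_num
    · obtain ⟨k, hk⟩ := IsPGroup.iff_card.1 P.2
      rw [htop, Subgroup.card_top, hcardN] at hk
      have : 3 ∣ 2 ^ k := hk ▸ by norm_num
      exact absurd (Nat.prime_three.dvd_of_dvd_pow this) (by norm_num)
  have hrange : Nat.card (N.map φ) = 60 := by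
    have hmap : N.map φ = (φ.comp N.subtype).range := by
      rw [MonoidHom.range_comp, N.range_subtype]
    rw [hmap, ← hcardN]
    exact (Nat.card_congr (MonoidHom.ofInjective hinj).toEquiv).symm
  have hcard : Nat.card (Perm (Sylow 2 N)) = 120 := by
    have h60 : 60 ∣ (Nat.card (Sylow 2 N)).factorial := by
      rw [← Nat.card_perm, ← hrange]
      exact Subgroup.card_subgroup_dvd_card _
    rw [Nat.card_perm]
    interval_cases Nat.card (Sylow 2 N) <;> revert h60 <;> decide
  refine ⟨_, _, _, φ, fun n hn h ↦ ?_, Perm.eq_alternatingGroup_of_index_eq_two ?_⟩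
  · exact congrArg Subtype.val (hinj (a₁ := ⟨n, hn⟩) (a₂ := 1) (by simpa using h))
  · have := (N.map φ).card_mul_index
    rw [hrange, hcard] at this
    omega

/-- Lemma 1.1(2) (group-theoretic content, case `2 ∣ I`): if a finite group `G`
has a normal subgroup `N ≅ A₅` with cyclic quotient of even order `I`, then the
extension splits: `N` has a cyclic complement of order `I` in `G`. -/
theorem stmt_9 (G : Type) [Group G] [Finite G] (N : Subgroup G) [N.Normal]
    (hN : Nonempty (N ≃* alternatingGroup (Fin 5)))
    (I : ℕ) (hI : Even I) (hcyc : IsCyclic (G ⧸ N))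
    (hcard : Nat.card (G ⧸ N) = I) :
    ∃ H : Subgroup G, H ⊓ N = ⊥ ∧ N ⊔ H = ⊤ ∧ IsCyclic H ∧ Nat.card H = I := by
  obtain ⟨e⟩ := hN
  subst hcard
  obtain ⟨α, _, _, f, hinj, hmap⟩ := exists_monoidHom_perm_map_eq_alternatingGroup N e
  obtain ⟨q, hq⟩ := hcyc.exists_generator
  obtain ⟨g, rfl⟩ := QuotientGroup.mk_surjective q
  obtain ⟨τ, hτ, hsq⟩ := (f g).exists_mul_alternatingGroup_sq_eq_one
  rw [← hmap] at hτ
  obtain ⟨n, hn, rfl⟩ := hτ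
  have hmk : ((g * n : G) : G ⧸ N) = g := QuotientGroup.mk_mul_of_mem g hn
  have hpow : (g * n) ^ Nat.card (G ⧸ N) = 1 := by
    apply hinj
    · rw [← QuotientGroup.eq_one_iff, QuotientGroup.mk_pow, pow_card_eq_one']
    · obtain ⟨k, hk⟩ := hI
      rw [map_pow, map_mul, hk, ← two_mul, pow_mul, hsq, one_pow]
  obtain ⟨hcompl, hcardH⟩ := N.isComplement'_zpowers_of_pow_eq_one (g * n)
    (by rw [hmk]; exact (Subgroup.eq_top_iff' _).2 hq) hpow
  exact ⟨Subgroup.zpowers (g * n), inf_comm N _ ▸ hcompl.disjoint.eq_bot, hcompl.sup_eq_top,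
    inferInstance, hcardH⟩
end

section
/- Let L be a free ℤ-module of finite rank with a symmetric ℤ-valued bilinear form B. Let S and T be submodules of L that are primitive (L/S and L/T are torsion-free) and mutually orthogonal (B(s,t) = 0 for all s ∈ S, t ∈ T), such that the quotient L/(S + T) is finite. Suppose T is free of rank 2 with a basis t₁, t₂ satisfying B(t₁,t₁) = B(t₂,t₂) = 2m for a positive integer m and B(t₁,t₂) = 0, and suppose g is a ℤ-linear automorphism of L preserving B such that g fixes S pointwise, g(t₁) = t₂, and g(t₂) = −t₁. Then the quotient group L/(S + T) is 2-elementary (every element x satisfies 2x = 0) and its cardinality divides 4. -/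
/-- An additive group in which any two nonzero elements sum to zero has at most two elements. -/
theorem natCard_dvd_two_of_add_eq_zero {Q : Type*} [AddCommGroup Q]
    (h : ∀ x y : Q, x ≠ 0 → y ≠ 0 → x + y = 0) : Nat.card Q ∣ 2 := by
  classical
  have hinj : Function.Injective (fun x : Q => decide (x = 0)) := by
    intro x y hxy
    have hiff : x = 0 ↔ y = 0 := by simpa using hxy
    by_cases hx : x = 0
    · rw [hx, hiff.1 hx]
    · have hy : y ≠ 0 := fun hy => hx (hiff.2 hy)
      exact (eq_neg_of_add_eq_zero_left (h x y hx hy)).trans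
        (eq_neg_of_add_eq_zero_left (h y y hy hy)).symm
  have : Finite Q := Finite.of_injective _ hinj
  have hle : Nat.card Q ≤ 2 := by
    simpa using Nat.card_le_card_of_injective _ hinj
  have hpos : 0 < Nat.card Q := Nat.card_pos
  interval_cases Nat.card Q <;> norm_num

/-- Lemma 3.4 (lattice-theoretic form): with `S, T` primitive mutually
orthogonal sublattices of `L`, `T` of rank 2 with Gram matrix `diag(2m, 2m)`,
and an isometry `g` of `L` fixing `S` pointwise with `g t₁ = t₂`,
`g t₂ = -t₁`, the finite quotient `L/(S + T)` is 2-elementary of order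
dividing 4. -/
theorem stmt_12 (L : Type) [AddCommGroup L] [Module ℤ L]
    [Module.Free ℤ L] [Module.Finite ℤ L]
    (B : LinearMap.BilinForm ℤ L)
    (hsymm : ∀ x y, B x y = B y x)
    (S T : Submodule ℤ L)
    (hSprim : ∀ (x : L) (n : ℤ), n ≠ 0 → n • x ∈ S → x ∈ S)
    (hTprim : ∀ (x : L) (n : ℤ), n ≠ 0 → n • x ∈ T → x ∈ T)
    (horth : ∀ s ∈ S, ∀ t ∈ T, B s t = 0)
    (t₁ t₂ : L) (ht₁ : t₁ ∈ T) (ht₂ : t₂ ∈ T)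
    (hTspan : T = Submodule.span ℤ ({t₁, t₂} : Set L))
    (hTind : LinearIndependent ℤ ![t₁, t₂])
    (m : ℤ) (hm : 0 < m)
    (hB11 : B t₁ t₁ = 2 * m) (hB22 : B t₂ t₂ = 2 * m) (hB12 : B t₁ t₂ = 0)
    (g : L ≃ₗ[ℤ] L) (hgB : ∀ x y, B (g x) (g y) = B x y)
    (hgS : ∀ s ∈ S, g s = s) (hgt₁ : g t₁ = t₂) (hgt₂ : g t₂ = -t₁)
    (hfin : Finite (L ⧸ (S ⊔ T))) :
    (∀ x : L ⧸ (S ⊔ T), x + x = 0) ∧ Nat.card (L ⧸ (S ⊔ T)) ∣ 4 := by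
  obtain rfl : ‹Module ℤ L› = AddCommGroup.toIntModule L := Subsingleton.elim _ _
  have : IsAddTorsionFree L := .of_isTorsionFree ℤ L
  have hT : ∀ t ∈ T, ∃ a b : ℤ, a • t₁ + b • t₂ = t := fun t ht => by
    rw [hTspan] at ht
    exact Submodule.mem_span_pair.1 ht
  have hmul : ∀ x : L, ∃ n : ℤ, n ≠ 0 ∧ ∃ s ∈ S, ∃ t ∈ T, s + t = n • x := by
    intro x
    refine ⟨Nat.card (L ⧸ (S ⊔ T)), by exact_mod_cast Nat.card_pos.ne', ?_⟩
    rw [← Submodule.mem_sup, ← Submodule.Quotient.mk_eq_zero, Submodule.Quotient.mk_smul,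
      natCast_zsmul]
    exact card_nsmul_eq_zero'
  have hgsub : ∀ x : L, g x - x ∈ T := by
    intro x
    obtain ⟨n, hn, s, hs, t, ht, hx⟩ := hmul x
    refine hTprim _ n hn ?_
    have hgt : g t ∈ T := by
      obtain ⟨a, b, rfl⟩ := hT t ht
      rw [map_add, map_zsmul, map_zsmul, hgt₁, hgt₂]
      exact T.add_mem (T.smul_mem a ht₂) (T.smul_mem b (T.neg_mem ht₁))
    have h : n • (g x - x) = g t - t := by
      rw [smul_sub, ← map_zsmul, ← hx, map_add, hgS s hs]
      abel
    rw [h]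
    exact T.sub_mem hgt ht
  have hfix : ∀ x : L, g x = x → x ∈ S := by
    intro x hgx
    obtain ⟨n, hn, s, hs, t, ht, hx⟩ := hmul x
    have hgt : g t = t := by
      have h := congrArg g hx
      rw [map_add, map_zsmul, hgx, ← hx, hgS s hs] at h
      exact add_left_cancel h
    have hggt : g (g t) = -t := by
      obtain ⟨a, b, rfl⟩ := hT t ht
      simp only [map_add, map_zsmul, map_neg, hgt₁, hgt₂]
      module
    have ht0 : t = 0 := by
      rw [hgt, hgt] at hggt
      exact self_eq_neg.1 hggt
    refine hSprim x n hn ?_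
    rwa [← hx, ht0, add_zero]
  have heven : ∀ (x : L) (a b : ℤ), g x - x = a • t₁ + b • t₂ → Even (a + b) → x ∈ S ⊔ T := by
    rintro x a b hx ⟨k, hk⟩
    obtain rfl : b = k + k - a := by lia
    have ht : (k - a) • t₁ - k • t₂ ∈ T := T.sub_mem (T.smul_mem _ ht₁) (T.smul_mem _ ht₂)
    have hs : x - ((k - a) • t₁ - k • t₂) ∈ S := by
      refine hfix _ ?_
      rw [map_sub, map_sub, map_zsmul, map_zsmul, hgt₁, hgt₂, eq_add_of_sub_eq hx]
      module
    exact Submodule.mem_sup.2 ⟨_, hs, _, ht, sub_add_cancel _ _⟩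
  have hadd : ∀ x y : L ⧸ (S ⊔ T), x ≠ 0 → y ≠ 0 → x + y = 0 := by
    intro x y
    induction x using Submodule.Quotient.induction_on with | _ x
    induction y using Submodule.Quotient.induction_on with | _ y
    rw [← Submodule.Quotient.mk_add]
    simp only [ne_eq, Submodule.Quotient.mk_eq_zero]
    intro hx hy
    obtain ⟨a, b, hab⟩ := hT _ (hgsub x)
    obtain ⟨c, d, hcd⟩ := hT _ (hgsub y)
    have hab' := Int.not_even_iff_odd.1 fun h => hx (heven x a b hab.symm h)
    have hcd' := Int.not_even_iff_odd.1 fun h => hy (heven y c d hcd.symm h)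
    refine heven (x + y) (a + c) (b + d) ?_ ?_
    · rw [map_add, add_sub_add_comm, ← hab, ← hcd]
      module
    · rw [add_add_add_comm]
      exact hab'.add_odd hcd'
  refine ⟨fun x => ?_, (natCard_dvd_two_of_add_eq_zero hadd).trans (by norm_num)⟩
  by_cases hx : x = 0
  · rw [hx, add_zero]
  · exact hadd x x hx hx
end

section
/- Let L be a free ℤ-module of finite rank with a symmetric ℤ-valued bilinear form B that is even (B(x,x) ∈ 2ℤ for all x ∈ L), containing submodules S and T such that: S and T are primitive (L/S and L/T torsion-free) and mutually orthogonal (B(s,t) = 0 for all s ∈ S, t ∈ T); S is free with basis u₁, u₂ satisfying B(u₁,u₁) = B(u₂,u₂) = 0, B(u₁,u₂) = 6; T is free with basis t₁, t₂ satisfying B(t₁,t₁) = B(t₂,t₂) = 10, B(t₁,t₂) = 0; and the quotient L/(S + T) has cardinality 2. Then t₁ + t₂ + u₁ + u₂ is divisible by 2 in L, and L is generated by S, T and θ = (t₁ + t₂ + u₁ + u₂)/2. -/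
/-- If `6ab + 5(c² + d²)` is divisible by `4`, then either `c` and `d` are both even,
or `a`, `b`, `c` and `d` are all odd. -/
theorem even_and_even_or_odd_of_four_dvd {a b c d : ℤ}
    (h : 4 ∣ 6 * (a * b) + 5 * (c * c + d * d)) :
    (Even c ∧ Even d) ∨ (Odd a ∧ Odd b ∧ Odd c ∧ Odd d) := by
  rcases Int.even_or_odd' a with ⟨p, rfl | rfl⟩ <;>
  rcases Int.even_or_odd' b with ⟨q, rfl | rfl⟩ <;>
  rcases Int.even_or_odd' c with ⟨r, rfl | rfl⟩ <;>
  rcases Int.even_or_odd' d with ⟨t, rfl | rfl⟩ <;>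
  first
  | exact Or.inl ⟨even_two_mul _, even_two_mul _⟩
  | exact Or.inr ⟨odd_two_mul_add_one _, odd_two_mul_add_one _, odd_two_mul_add_one _,
      odd_two_mul_add_one _⟩
  | (exfalso; ring_nf at h; omega)

/-- Lemma 3.8(1): if an even lattice `L` contains primitive mutually orthogonal
sublattices `S ≅ U(6)` (basis `u₁, u₂`, Gram `[[0,6],[6,0]]`) and `T` (basis
`t₁, t₂`, Gram `diag(10,10)`) with `|L/(S + T)| = 2`, then
`θ = (t₁ + t₂ + u₁ + u₂)/2 ∈ L` and `L` is generated by `S`, `T` and `θ`. -/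
theorem stmt_16 (L : Type) [AddCommGroup L] [Module ℤ L]
    [Module.Free ℤ L] [Module.Finite ℤ L]
    (B : LinearMap.BilinForm ℤ L)
    (hsymm : ∀ x y, B x y = B y x)
    (heven : ∀ x : L, 2 ∣ B x x)
    (S T : Submodule ℤ L)
    (hSprim : ∀ (x : L) (n : ℤ), n ≠ 0 → n • x ∈ S → x ∈ S)
    (hTprim : ∀ (x : L) (n : ℤ), n ≠ 0 → n • x ∈ T → x ∈ T)
    (horth : ∀ s ∈ S, ∀ t ∈ T, B s t = 0)
    (u₁ u₂ : L) (hu₁ : u₁ ∈ S) (hu₂ : u₂ ∈ S)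
    (hSspan : S = Submodule.span ℤ ({u₁, u₂} : Set L))
    (hSind : LinearIndependent ℤ ![u₁, u₂])
    (hBu11 : B u₁ u₁ = 0) (hBu22 : B u₂ u₂ = 0) (hBu12 : B u₁ u₂ = 6)
    (t₁ t₂ : L) (ht₁ : t₁ ∈ T) (ht₂ : t₂ ∈ T)
    (hTspan : T = Submodule.span ℤ ({t₁, t₂} : Set L))
    (hTind : LinearIndependent ℤ ![t₁, t₂])
    (hB11 : B t₁ t₁ = 10) (hB22 : B t₂ t₂ = 10) (hB12 : B t₁ t₂ = 0)
    (hcard : Nat.card (L ⧸ (S ⊔ T)) = 2) :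
    ∃ θ : L, (2 : ℤ) • θ = t₁ + t₂ + u₁ + u₂ ∧
      S ⊔ T ⊔ Submodule.span ℤ ({θ} : Set L) = ⊤ := by
  obtain rfl : ‹Module ℤ L› = AddCommGroup.toIntModule L := Subsingleton.elim _ _
  have hidx : (S ⊔ T).toAddSubgroup.index = 2 := hcard
  have hadd {y z : L} : y + z ∈ S ⊔ T ↔ (y ∈ S ⊔ T ↔ z ∈ S ⊔ T) :=
    AddSubgroup.add_mem_iff_of_index_two hidx
  obtain ⟨x, hx⟩ : ∃ x, x ∉ S ⊔ T := by
    by_contra! h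
    have htop : S ⊔ T = ⊤ := eq_top_iff.2 fun y _ => h y
    simp [htop] at hidx
  obtain ⟨s, hs, t, ht, hst⟩ := Submodule.mem_sup.1 (hadd.2 (Iff.rfl : x ∈ S ⊔ T ↔ _))
  have hs' := hs
  have ht' := ht
  rw [hSspan, Submodule.mem_span_pair] at hs'
  rw [hTspan, Submodule.mem_span_pair] at ht'
  obtain ⟨a, b, rfl⟩ := hs'
  obtain ⟨c, d, rfl⟩ := ht'
  have hnorm : 4 * B x x = 12 * (a * b) + 10 * (c * c + d * d) := by
    have h : B (x + x) (x + x) = 4 * B x x := by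
      simp only [map_add, LinearMap.add_apply]
      ring
    rw [← h, ← hst]
    simp only [map_add, map_smul, LinearMap.add_apply, LinearMap.smul_apply, smul_eq_mul,
      hBu11, hBu22, hBu12, hsymm u₂ u₁, hB11, hB22, hB12, hsymm t₂ t₁,
      horth _ hu₁ _ ht₁, horth _ hu₁ _ ht₂, horth _ hu₂ _ ht₁, horth _ hu₂ _ ht₂,
      hsymm t₁ u₁, hsymm t₁ u₂, hsymm t₂ u₁, hsymm t₂ u₂]
    ring
  have hdvd : 4 ∣ 6 * (a * b) + 5 * (c * c + d * d) := by
    have := heven x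
    omega
  rcases even_and_even_or_odd_of_four_dvd hdvd with
    ⟨⟨r, rfl⟩, ⟨k, rfl⟩⟩ | ⟨⟨p, rfl⟩, ⟨q, rfl⟩, ⟨r, rfl⟩, ⟨k, rfl⟩⟩
  · refine absurd ?_ hx
    have hT : r • t₁ + k • t₂ ∈ T := T.add_mem (T.smul_mem r ht₁) (T.smul_mem k ht₂)
    have hS : x - (r • t₁ + k • t₂) ∈ S := by
      refine hSprim _ 2 two_ne_zero ?_
      convert hs using 1
      linear_combination (norm := module) (-1 : ℤ) • hst
    exact Submodule.mem_sup.2 ⟨_, hS, _, hT, sub_add_cancel _ _⟩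
  · have hw : p • u₁ + q • u₂ + (r • t₁ + k • t₂) ∈ S ⊔ T :=
      Submodule.add_mem_sup (S.add_mem (S.smul_mem p hu₁) (S.smul_mem q hu₂))
        (T.add_mem (T.smul_mem r ht₁) (T.smul_mem k ht₂))
    set w := p • u₁ + q • u₂ + (r • t₁ + k • t₂) with hw_def
    have hθ : x - w ∉ S ⊔ T := fun h => hx (((S ⊔ T).sub_mem_iff_left hw).1 h)
    refine ⟨x - w, ?_, ?_⟩
    · rw [hw_def]
      linear_combination (norm := module) (-1 : ℤ) • hst
    · refine eq_top_iff.2 fun y _ => ?_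
      by_cases hy : y ∈ S ⊔ T
      · exact Submodule.mem_sup_left hy
      · have hsum : y + (x - w) ∈ S ⊔ T := hadd.2 (iff_of_false hy hθ)
        rw [← add_sub_cancel_right y (x - w)]
        exact Submodule.sub_mem _ (Submodule.mem_sup_left hsum)
          (Submodule.mem_sup_right (Submodule.mem_span_singleton_self _))
end

section
/- Equip the ℚ-vector space ℚ⁴ with standard basis e₁, e₂, e₃, e₄ and the symmetric bilinear form B with Gram matrix [[10,0,0,0],[0,10,0,0],[0,0,0,6],[0,0,6,0]]. Let L ⊂ ℚ⁴ be the ℤ-submodule generated by e₁, e₂, e₃, e₄ and θ = (e₁+e₂+e₃+e₄)/2, and let L∨ = {x ∈ ℚ⁴ : B(x,y) ∈ ℤ for all y ∈ L} be its dual. Set δ₁ = (1/10)e₂ + (1/6)(2e₃ + e₄) and δ₂ = (1/10)e₁ + (1/6)e₄. Then: δ₁, δ₂ ∈ L∨; B(δ₁,δ₁) = 23/30, B(δ₂,δ₂) = 1/10, B(δ₁,δ₂) = 1/3; and the quotient group L∨/L is generated by the cosets of δ₁ and δ₂ and is isomorphic to (ℤ/30ℤ) ⊕ (ℤ/30ℤ).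 -/
namespace Stmt17

/-- The bilinear form on `ℚ⁴` with Gram matrix
`[[10,0,0,0],[0,10,0,0],[0,0,0,6],[0,0,6,0]]` in the standard basis. -/
def B (x y : Fin 4 → ℚ) : ℚ :=
  10 * x 0 * y 0 + 10 * x 1 * y 1 + 6 * x 2 * y 3 + 6 * x 3 * y 2

/-- The standard basis vectors of `ℚ⁴`. -/
def e (i : Fin 4) : Fin 4 → ℚ := Pi.single i 1

/-- `θ = (e₁ + e₂ + e₃ + e₄)/2`. -/
noncomputable def θ : Fin 4 → ℚ := (1 / 2 : ℚ) • (e 0 + e 1 + e 2 + e 3)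

/-- The lattice `L ⊂ ℚ⁴` generated by `e₁, e₂, e₃, e₄` and `θ`. -/
noncomputable def L : Submodule ℤ (Fin 4 → ℚ) :=
  Submodule.span ℤ ({e 0, e 1, e 2, e 3, θ} : Set (Fin 4 → ℚ))

/-- The dual lattice `L∨ = {x ∈ ℚ⁴ : B(x, y) ∈ ℤ for all y ∈ L}`. -/
noncomputable def Ldual : Submodule ℤ (Fin 4 → ℚ) where
  carrier := {x | ∀ y ∈ L, ∃ n : ℤ, B x y = (n : ℚ)}
  zero_mem' := by
    intro y _
    exact ⟨0, by simp [B]⟩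
  add_mem' := by
    intro a b ha hb y hy
    obtain ⟨n, hn⟩ := ha y hy
    obtain ⟨p, hp⟩ := hb y hy
    refine ⟨n + p, ?_⟩
    simp only [B, Pi.add_apply] at hn hp ⊢
    push_cast
    linarith
  smul_mem' := by
    intro c x hx y hy
    obtain ⟨n, hn⟩ := hx y hy
    refine ⟨c * n, ?_⟩
    simp only [B, Pi.smul_apply, zsmul_eq_mul] at hn ⊢
    push_cast
    linear_combination (c : ℚ) * hn

/-- `δ₁ = (1/10) e₂ + (1/6)(2 e₃ + e₄)`. -/
noncomputable def δ₁ : Fin 4 → ℚ :=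
  (1 / 10 : ℚ) • e 1 + (1 / 6 : ℚ) • ((2 : ℚ) • e 2 + e 3)

/-- `δ₂ = (1/10) e₁ + (1/6) e₄`. -/
noncomputable def δ₂ : Fin 4 → ℚ := (1 / 10 : ℚ) • e 0 + (1 / 6 : ℚ) • e 3

/-- A vector lies in `L` exactly when its coordinates are all integers or all half-integers. -/
lemma mem_L_iff (x : Fin 4 → ℚ) :
    x ∈ L ↔ ∃ k p q r s : ℤ, x 0 = p + k / 2 ∧ x 1 = q + k / 2 ∧ x 2 = r + k / 2 ∧
      x 3 = s + k / 2 := by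
  rw [L]
  simp only [Submodule.mem_span_insert, Submodule.mem_span_singleton]
  constructor
  · rintro ⟨p, _, ⟨q, _, ⟨r, _, ⟨s, _, ⟨k, rfl⟩, rfl⟩, rfl⟩, rfl⟩, rfl⟩
    refine ⟨k, p, q, r, s, ?_, ?_, ?_, ?_⟩ <;> simp [e, θ] <;> ring
  · rintro ⟨k, p, q, r, s, h0, h1, h2, h3⟩
    refine ⟨p, _, ⟨q, _, ⟨r, _, ⟨s, _, ⟨k, rfl⟩, rfl⟩, rfl⟩, rfl⟩, ?_⟩
    ext i
    fin_cases i <;> simp [e, θ, h0, h1, h2, h3] <;> ring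

lemma mem_Ldual_iff (x : Fin 4 → ℚ) :
    x ∈ Ldual ↔ ∃ a b c d t : ℤ, 10 * x 0 = a ∧ 10 * x 1 = b ∧ 6 * x 3 = c ∧ 6 * x 2 = d ∧
      a + b + c + d = 2 * t := by
  constructor
  · intro h
    have basis_mem (i : Fin 4) : e i ∈ L :=
      Submodule.subset_span (by fin_cases i <;> simp)
    obtain ⟨a, ha⟩ := h _ (basis_mem 0)
    obtain ⟨b, hb⟩ := h _ (basis_mem 1)
    obtain ⟨c, hc⟩ := h _ (basis_mem 2)
    obtain ⟨d, hd⟩ := h _ (basis_mem 3)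
    obtain ⟨t, ht⟩ := h θ (Submodule.subset_span (by simp))
    simp [B, e, θ] at ha hb hc hd ht
    refine ⟨a, b, c, d, t, ha, hb, hc, hd, ?_⟩
    have : (a + b + c + d : ℚ) = 2 * t := by linarith
    exact_mod_cast this
  · rintro ⟨a, b, c, d, t, ha, hb, hc, hd, ht⟩ y hy
    obtain ⟨k, p, q, r, s, h0, h1, h2, h3⟩ := (mem_L_iff y).1 hy
    refine ⟨a * p + b * q + c * r + d * s + t * k, ?_⟩
    have ht' : (a + b + c + d : ℚ) = 2 * t := by exact_mod_cast ht
    simp only [B, h0, h1, h2, h3, ha, hb, hc, hd]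
    push_cast
    linear_combination (k / 2 : ℚ) * ht'

lemma δ₁_eq : δ₁ = ![0, 1 / 10, 1 / 3, 1 / 6] := by
  ext i
  fin_cases i <;> simp [δ₁, e]
  norm_num

lemma δ₂_eq : δ₂ = ![1 / 10, 0, 0, 1 / 6] := by
  ext i
  fin_cases i <;> simp [δ₂, e]

lemma δ₁_mem_Ldual : δ₁ ∈ Ldual :=
  (mem_Ldual_iff _).2 ⟨0, 1, 1, 2, 2, by simp [δ₁_eq]; norm_num⟩

lemma δ₂_mem_Ldual : δ₂ ∈ Ldual :=
  (mem_Ldual_iff _).2 ⟨1, 0, 1, 0, 1, by simp [δ₂_eq]⟩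

lemma zsmul_δ₁_add_zsmul_δ₂ (n m : ℤ) :
    n • δ₁ + m • δ₂ = ![(m / 10 : ℚ), n / 10, n / 3, (n + m) / 6] := by
  ext i
  fin_cases i <;> simp [δ₁_eq, δ₂_eq] <;> ring

lemma zsmul_δ₁_add_zsmul_δ₂_mem_L_iff (n m : ℤ) :
    n • δ₁ + m • δ₂ ∈ L ↔ 30 ∣ n ∧ 30 ∣ m := by
  rw [mem_L_iff, zsmul_δ₁_add_zsmul_δ₂]
  constructor
  · rintro ⟨k, p, q, r, s, h0, h1, h2, h3⟩
    simp only [Matrix.cons_val] at h0 h1 h2 h3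
    field_simp at h0 h1 h2 h3
    norm_cast at h0 h1 h2 h3
    omega
  · rintro ⟨⟨u, rfl⟩, ⟨v, rfl⟩⟩
    refine ⟨0, 3 * v, 3 * u, 10 * u, 5 * (u + v), ?_, ?_, ?_, ?_⟩ <;>
      simp only [Matrix.cons_val] <;> push_cast <;> ring

lemma exists_zsmul_add_zsmul_sub_mem_L {x : Fin 4 → ℚ} (hx : x ∈ Ldual) :
    ∃ n m : ℤ, n • δ₁ + m • δ₂ - x ∈ L := by
  obtain ⟨a, b, c, d, t, ha, hb, hc, hd, ht⟩ := (mem_Ldual_iff x).1 hx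
  have ht' : (a + b + c + d : ℚ) = 2 * t := by exact_mod_cast ht
  refine ⟨21 * b + 5 * d, 21 * a + 10 * c - 5 * d, (mem_L_iff _).2
    ⟨-d, 2 * a + c, 2 * b + d, 7 * b + 2 * d, 7 * t - 2 * c - 3 * d, ?_⟩⟩
  simp only [zsmul_δ₁_add_zsmul_δ₂, Pi.sub_apply, Matrix.cons_val]
  push_cast
  refine ⟨?_, ?_, ?_, ?_⟩ <;> linarith

/-- The additive group generated by `g` and `h` is `(ℤ/N)²` if the relations between `g` and `h`
are exactly those with both coefficients divisible by `N`. -/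
lemma nonempty_addEquiv_zmod_prod {Q : Type*} [AddCommGroup Q] (N : ℕ) (g h : Q)
    (span_eq : Submodule.span ℤ {g, h} = ⊤)
    (rel : ∀ n m : ℤ, n • g + m • h = 0 ↔ (N : ℤ) ∣ n ∧ (N : ℤ) ∣ m) :
    Nonempty (Q ≃+ ZMod N × ZMod N) := by
  have hg : zmultiplesHom Q g N = 0 := by simpa using (rel N 0).2 (by simp)
  have hh : zmultiplesHom Q h N = 0 := by simpa using (rel 0 N).2 (by simp)
  let f : ZMod N × ZMod N →+ Q :=
    (ZMod.lift N ⟨zmultiplesHom Q g, hg⟩).coprod (ZMod.lift N ⟨zmultiplesHom Q h, hh⟩)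
  have f_intCast (n m : ℤ) : f (n, m) = n • g + m • h := by
    simp [f]
  refine ⟨(AddEquiv.ofBijective f ⟨(injective_iff_map_eq_zero f).2 ?_, fun x => ?_⟩).symm⟩
  · rintro ⟨u, v⟩ huv
    obtain ⟨n, rfl⟩ := ZMod.intCast_surjective u
    obtain ⟨m, rfl⟩ := ZMod.intCast_surjective v
    rw [f_intCast, rel] at huv
    simpa [ZMod.intCast_zmod_eq_zero_iff_dvd] using huv
  · have hx : x ∈ Submodule.span ℤ {g, h} := span_eq ▸ Submodule.mem_top
    obtain ⟨n, m, rfl⟩ := Submodule.mem_span_pair.1 hx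
    exact ⟨(n, m), f_intCast n m⟩

/-- Lemma 3.8(2): `δ₁, δ₂` lie in the dual lattice `L∨`, have the stated
intersection numbers `B(δ₁,δ₁) = 23/30`, `B(δ₂,δ₂) = 1/10`, `B(δ₁,δ₂) = 1/3`,
and their cosets generate the discriminant group `L∨/L ≅ (ℤ/30) ⊕ (ℤ/30)`. -/
theorem stmt_17 :
    B δ₁ δ₁ = 23 / 30 ∧ B δ₂ δ₂ = 1 / 10 ∧ B δ₁ δ₂ = 1 / 3 ∧
    ∃ (h₁ : δ₁ ∈ Ldual) (h₂ : δ₂ ∈ Ldual),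
      Submodule.span ℤ
          ({Submodule.Quotient.mk (⟨δ₁, h₁⟩ : Ldual),
            Submodule.Quotient.mk (⟨δ₂, h₂⟩ : Ldual)} :
            Set (Ldual ⧸ L.comap Ldual.subtype)) = ⊤ ∧
      Nonempty ((Ldual ⧸ L.comap Ldual.subtype) ≃+ ZMod 30 × ZMod 30) := by
  refine ⟨?_, ?_, ?_, δ₁_mem_Ldual, δ₂_mem_Ldual, ?_⟩
  · simp only [B, δ₁_eq, Matrix.cons_val]; norm_num
  · simp only [B, δ₂_eq, Matrix.cons_val]; norm_num
  · simp only [B, δ₁_eq, δ₂_eq, Matrix.cons_val]; norm_num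
  have span_eq : Submodule.span ℤ
      ({Submodule.Quotient.mk (⟨δ₁, δ₁_mem_Ldual⟩ : Ldual),
        Submodule.Quotient.mk (⟨δ₂, δ₂_mem_Ldual⟩ : Ldual)} :
        Set (Ldual ⧸ L.comap Ldual.subtype)) = ⊤ := by
    refine eq_top_iff.2 fun x _ => ?_
    obtain ⟨⟨x, hx⟩, rfl⟩ := Submodule.Quotient.mk_surjective _ x
    obtain ⟨n, m, h⟩ := exists_zsmul_add_zsmul_sub_mem_L hx
    refine Submodule.mem_span_pair.2 ⟨n, m, ?_⟩
    rw [← Submodule.Quotient.mk_smul, ← Submodule.Quotient.mk_smul, ← Submodule.Quotient.mk_add,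
      Submodule.Quotient.eq]
    exact h
  refine ⟨span_eq, nonempty_addEquiv_zmod_prod 30 _ _ span_eq fun n m => ?_⟩
  rw [← Submodule.Quotient.mk_smul, ← Submodule.Quotient.mk_smul, ← Submodule.Quotient.mk_add,
    Submodule.Quotient.mk_eq_zero]
  exact zsmul_δ₁_add_zsmul_δ₂_mem_L_iff n m

end Stmt17
end

section
/- Let PGL₂(ℂ) denote the quotient of the group GL₂(ℂ) of invertible 2×2 complex matrices by its center. Then there exists an injective group homomorphism from the alternating group A₅ on 5 letters into PGL₂(ℂ), but there is no injective group homomorphism from the symmetric group S₅ on 5 letters (Equiv.Perm (Fin 5)) into PGL₂(ℂ). -/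
open Equiv Matrix MatrixGroups LinearAlgebra.Projectivization

section NoEmbedding

variable {K : Type*} [Field K]

/-- By Cayley–Hamilton, `S ^ 5` is a combination of `S` and `1` whose `S`-coefficient is a
polynomial in the trace and the determinant. -/
lemma Matrix.pow_five_fin_two (S : Matrix (Fin 2) (Fin 2) K) :
    S ^ 5 = (S.trace ^ 4 - 3 * S.trace ^ 2 * S.det + S.det ^ 2) • S
      + (2 * S.trace * S.det ^ 2 - S.trace ^ 3 * S.det) • 1 := by
  rw [← Matrix.ext_iff]
  simp only [Fin.forall_fin_two, pow_succ, pow_zero, one_mul, Matrix.mul_apply, Fin.sum_univ_two,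
    Matrix.add_apply, Matrix.smul_apply, smul_eq_mul, Matrix.trace_fin_two, Matrix.det_fin_two,
    Matrix.one_apply_eq, Matrix.one_apply_ne (zero_ne_one : (0 : Fin 2) ≠ 1),
    Matrix.one_apply_ne (one_ne_zero : (1 : Fin 2) ≠ 0)]
  refine ⟨⟨?_, ?_⟩, ?_, ?_⟩ <;> ring

lemma Matrix.GeneralLinearGroup.mem_center_of_smul_eq {g : GL (Fin 2) K} {a b : K} (ha : a ≠ 0)
    (h : a • (g : Matrix (Fin 2) (Fin 2) K) = b • 1) : g ∈ Subgroup.center (GL (Fin 2) K) := by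
  rw [Matrix.GeneralLinearGroup.mem_center_iff_val_mem_range_scalar]
  refine ⟨a⁻¹ * b, ?_⟩
  rw [← inv_smul_smul₀ ha (g : Matrix (Fin 2) (Fin 2) K), h, smul_smul]
  exact (Matrix.smul_one_eq_diagonal _).symm

/-- In `PGL₂`, an element of order dividing `5` that is conjugate to its square is trivial. -/
lemma Matrix.ProjGenLinGroup.eq_one_of_pow_five_eq_one_of_conj [CharZero K] {s u : PGL(2, K)}
    (hs : s ^ 5 = 1) (hu : u * s * u⁻¹ = s ^ 2) : s = 1 := by
  cases s with | mk S => ?_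
  cases u with | mk U => ?_
  rw [← map_pow, ProjGenLinGroup.mk_eq_one,
    GeneralLinearGroup.mem_center_iff_val_mem_range_scalar] at hs
  obtain ⟨k, hk⟩ := hs
  rw [← map_inv, ← map_mul, ← map_mul, ← map_pow, ProjGenLinGroup.mk_eq_mk_iff] at hu
  obtain ⟨c, hc⟩ := hu
  rw [ProjGenLinGroup.mk_eq_one]
  set M : Matrix (Fin 2) (Fin 2) K := S.val with hM
  have hd : M.det ≠ 0 := (Matrix.isUnits_det_units S).ne_zero
  have hV : (c : K) • ((U : Matrix (Fin 2) (Fin 2) K) * M * (U⁻¹ : GL (Fin 2) K)) = M ^ 2 := by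
    have := congrArg (Units.val) hc
    simpa [← Matrix.smul_eq_mul_diagonal, hM] using this
  have htr : (c : K) * M.trace = M.trace ^ 2 - 2 * M.det := by
    have := congrArg Matrix.trace hV
    rw [Matrix.trace_smul, Matrix.trace_mul_comm, ← Matrix.mul_assoc, ← Units.val_mul,
      inv_mul_cancel, Units.val_one, one_mul, smul_eq_mul] at this
    rw [this]
    simp only [pow_two, Matrix.trace_fin_two, Matrix.det_fin_two, Matrix.mul_apply,
      Fin.sum_univ_two]
    ring
  have hdet : (c : K) ^ 2 * M.det = M.det ^ 2 := by
    have := congrArg Matrix.det hV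
    rw [Matrix.det_smul, Matrix.det_mul_comm, ← Matrix.mul_assoc, ← Units.val_mul,
      inv_mul_cancel, Units.val_one, one_mul, Matrix.det_pow] at this
    simpa using this
  have hc2 : (c : K) ^ 2 = M.det := mul_right_cancel₀ hd (by rw [hdet, pow_two])
  have hk' : M ^ 5 = k • 1 := by
    rw [Matrix.smul_one_eq_diagonal]
    simpa [hM] using hk.symm
  rw [Matrix.pow_five_fin_two, ← eq_sub_iff_add_eq, ← sub_smul] at hk'
  refine GeneralLinearGroup.mem_center_of_smul_eq (fun h0 ↦ hd ?_) hk'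
  have h1 : M.trace ^ 2 * M.det = (M.trace ^ 2 - 2 * M.det) ^ 2 := by
    rw [← htr, ← hc2]; ring
  have h2 : M.det * (2 * M.trace ^ 2 - 3 * M.det) = 0 := by linear_combination h0 + h1
  have h3 : 2 * M.trace ^ 2 - 3 * M.det = 0 := (mul_eq_zero.mp h2).resolve_left hd
  have h4 : (5 : K) * M.det ^ 2 = 0 := by
    linear_combination (2 * M.trace ^ 2 - 3 * M.det) * h3 - 4 * h0
  simpa using h4

set_option maxRecDepth 4000 in
theorem not_injective_perm_five_PGL [CharZero K] (f : Perm (Fin 5) →* PGL(2, K)) :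
    ¬ Function.Injective f := by
  intro hf
  have h5 : (c[0, 1, 2, 3, 4] : Perm (Fin 5)) ^ 5 = 1 := by decide
  have hu : (c[1, 2, 4, 3] : Perm (Fin 5)) * c[0, 1, 2, 3, 4] * c[1, 2, 4, 3]⁻¹
      = c[0, 1, 2, 3, 4] ^ 2 := by decide
  have h1 := ProjGenLinGroup.eq_one_of_pow_five_eq_one_of_conj
    (s := f c[0, 1, 2, 3, 4]) (u := f c[1, 2, 4, 3])
    (by rw [← map_pow, h5, map_one]) (by rw [← map_inv, ← map_mul, ← map_mul, hu, map_pow])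
  rw [map_eq_one_iff f hf] at h1
  revert h1
  decide

end NoEmbedding

section Embedding

/-- A subgroup of `A × G` that projects bijectively to a simple group `A`, and that does not contain
`A × 1`, is the graph of an embedding of `A` into `G`. -/
lemma exists_injective_of_subgroup_prod {A G : Type*} [Group A] [Group G] [IsSimpleGroup A]
    (L : Subgroup (A × G)) (hsurj : ∀ a, ∃ g, (a, g) ∈ L) (hone : ∀ g, (1, g) ∈ L → g = 1)
    {a : A} (ha : (a, 1) ∉ L) : ∃ f : A →* G, Function.Injective f := by
  have hbij : Function.Bijective (Prod.fst ∘ L.subtype) := by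
    refine ⟨?_, fun a ↦ let ⟨g, hg⟩ := hsurj a; ⟨⟨(a, g), hg⟩, rfl⟩⟩
    rintro ⟨⟨a, g⟩, hg⟩ ⟨⟨b, h⟩, hh⟩ (rfl : a = b)
    have := hone (g * h⁻¹) (by simpa using L.mul_mem hg (L.inv_mem hh))
    simpa using mul_inv_eq_one.mp this
  obtain ⟨f, hf⟩ := Subgroup.exists_eq_graph hbij
  refine ⟨f, (MonoidHom.ker_eq_bot_iff f).mp ?_⟩
  refine f.normal_ker.eq_bot_or_eq_top.resolve_right fun htop ↦ ha ?_
  rw [hf, MonoidHom.mem_graph]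
  exact MonoidHom.mem_ker.mp (htop ▸ Subgroup.mem_top a)

/-- The pairs of a permutation and a transformation of `X` that, acting by conjugation on the family
`x` and by the given action on the family `P`, permute both families in the same way. -/
def compatibleSubgroup {ι α G X : Type*} [Group G] [MulAction G X] (x : ι → Perm α) (P : ι → X) :
    Subgroup (Perm α × G) where
  carrier := {p | ∃ π : Perm ι, (∀ i, p.1 * x i = x (π i) * p.1) ∧ ∀ i, p.2 • P i = P (π i)}
  one_mem' := ⟨1, by simp, by simp⟩
  mul_mem' := by
    rintro ⟨a, g⟩ ⟨b, h⟩ ⟨π, hπ, hP⟩ ⟨ρ, hρ, hQ⟩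
    refine ⟨π * ρ, fun i ↦ ?_, fun i ↦ ?_⟩
    · rw [Prod.fst_mul, mul_assoc, hρ, ← mul_assoc, hπ, mul_assoc, Perm.mul_apply]
    · rw [Prod.snd_mul, mul_smul, hQ, hP, Perm.mul_apply]
  inv_mem' := by
    rintro ⟨a, g⟩ ⟨π, hπ, hP⟩
    refine ⟨π.symm, fun i ↦ ?_, fun i ↦ ?_⟩
    · have := hπ (π.symm i)
      rw [Equiv.apply_symm_apply] at this
      rw [Prod.fst_inv, inv_mul_eq_iff_eq_mul, ← mul_assoc, this, mul_inv_cancel_right]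
    · have := hP (π.symm i)
      rw [Equiv.apply_symm_apply] at this
      rw [Prod.snd_inv, inv_smul_eq_iff, this]

lemma smul_eq_of_one_mem_compatibleSubgroup {ι α G X : Type*} [Group G] [MulAction G X]
    {x : ι → Perm α} (hx : Function.Injective x) {P : ι → X} {g : G}
    (hg : ((1 : Perm α), g) ∈ compatibleSubgroup x P) (i : ι) : g • P i = P i := by
  obtain ⟨π, hπ, hP⟩ := hg
  have : i = π i := hx (by simpa using hπ i)
  rw [hP i, ← this]

lemma alternatingGroup_five_le {H : Subgroup (Perm (Fin 5))} (hs : c[0, 1, 2, 3, 4] ∈ H)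
    (ht : c[1, 2] * c[3, 4] ∈ H) : alternatingGroup (Fin 5) ≤ H := by
  have key : ∀ σ : Perm (Fin 5), Perm.sign σ = 1 → ∃ a b : Fin 5,
      σ = c[0, 1, 2, 3, 4] ^ (a : ℕ) ∨
      σ = c[0, 1, 2, 3, 4] ^ (a : ℕ) * (c[1, 2] * c[3, 4]) * c[0, 1, 2, 3, 4] ^ (b : ℕ) ∨
      σ = c[0, 1, 2, 3, 4] ^ (a : ℕ) * (c[1, 2] * c[3, 4]) * c[0, 1, 2, 3, 4] ^ 2 *
        (c[1, 2] * c[3, 4]) * c[0, 1, 2, 3, 4] ^ (b : ℕ) ∨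
      σ = c[0, 1, 2, 3, 4] ^ (a : ℕ) * (c[1, 2] * c[3, 4]) * c[0, 1, 2, 3, 4] ^ 2 *
        (c[1, 2] * c[3, 4]) * c[0, 1, 2, 3, 4] ^ (b : ℕ) * (c[1, 2] * c[3, 4]) := by
    decide +kernel
  intro σ hσ
  have hp (n : ℕ) : c[0, 1, 2, 3, 4] ^ n ∈ H := H.pow_mem hs n
  obtain ⟨a, b, rfl | rfl | rfl | rfl⟩ := key σ (Perm.mem_alternatingGroup.mp hσ)
  · exact hp _
  · exact H.mul_mem (H.mul_mem (hp _) ht) (hp _)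
  · exact H.mul_mem (H.mul_mem (H.mul_mem (H.mul_mem (hp _) ht) (hp _)) ht) (hp _)
  · exact H.mul_mem (H.mul_mem (H.mul_mem (H.mul_mem (H.mul_mem (hp _) ht) (hp _)) ht) (hp _)) ht

/-- One of the two conjugacy classes of `5`-cycles of `A₅`, in the order of
`icosahedronVertex`. -/
def icosahedronRotation : Fin 12 → Perm (Fin 5) :=
  ![c[0, 1, 2, 3, 4], c[0, 4, 3, 2, 1], c[0, 3, 4, 1, 2], c[0, 2, 3, 1, 4], c[0, 1, 3, 4, 2],
    c[0, 3, 1, 2, 4], c[0, 1, 4, 2, 3], c[0, 2, 1, 4, 3], c[0, 4, 1, 3, 2], c[0, 2, 4, 3, 1],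
    c[0, 4, 2, 1, 3], c[0, 3, 2, 4, 1]]

lemma icosahedronRotation_injective : Function.Injective icosahedronRotation := by
  decide +kernel

variable {K : Type*} [Field K]

lemma Projectivization.mk_eq_mk_of_mul_eq_mul {v w : Fin 2 → K} (hv : v ≠ 0) (hw : w ≠ 0)
    (h : v 0 * w 1 = v 1 * w 0) : Projectivization.mk K v hv = Projectivization.mk K w hw := by
  rw [Projectivization.mk_eq_mk_iff']
  by_cases h0 : w 0 = 0
  · have h1 : w 1 ≠ 0 := fun h1 ↦ hw (by ext i; fin_cases i; exacts [h0, h1])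
    refine ⟨v 1 / w 1, funext (Fin.forall_fin_two.mpr ⟨?_, div_mul_cancel₀ _ h1⟩)⟩
    rw [Pi.smul_apply, smul_eq_mul, div_mul_eq_mul_div, div_eq_iff h1, h]
  · refine ⟨v 0 / w 0, funext (Fin.forall_fin_two.mpr ⟨div_mul_cancel₀ _ h0, ?_⟩)⟩
    rw [Pi.smul_apply, smul_eq_mul, div_mul_eq_mul_div, div_eq_iff h0, h]

lemma Projectivization.mul_eq_mul_of_mk_eq_mk {v w : Fin 2 → K} {hv : v ≠ 0} {hw : w ≠ 0}
    (h : Projectivization.mk K v hv = Projectivization.mk K w hw) : v 0 * w 1 = v 1 * w 0 := by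
  obtain ⟨a, rfl⟩ := (Projectivization.mk_eq_mk_iff' ..).mp h
  simp only [Pi.smul_apply, smul_eq_mul]
  ring

lemma Matrix.GeneralLinearGroup.smul_fin_two_apply (g : GL (Fin 2) K) (v : Fin 2 → K)
    (i : Fin 2) : (g • v) i = g i 0 * v 0 + g i 1 * v 1 :=
  Fin.sum_univ_two fun j ↦ g i j * v j

/-- Homogeneous coordinates on `ℙ¹` of the vertices of a regular icosahedron inscribed in the
Riemann sphere, where `ε` is a primitive fifth root of unity. -/
def icosahedronCoord (ε : K) : Fin 12 → Fin 2 → K :=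
  ![![1, 0], ![0, 1],
    ![ε + ε ^ 4, 1], ![ε * (ε + ε ^ 4), 1], ![ε ^ 2 * (ε + ε ^ 4), 1], ![ε ^ 3 * (ε + ε ^ 4), 1],
    ![ε ^ 4 * (ε + ε ^ 4), 1],
    ![ε ^ 2 + ε ^ 3, 1], ![ε * (ε ^ 2 + ε ^ 3), 1], ![ε ^ 2 * (ε ^ 2 + ε ^ 3), 1],
    ![ε ^ 3 * (ε ^ 2 + ε ^ 3), 1], ![ε ^ 4 * (ε ^ 2 + ε ^ 3), 1]]

lemma icosahedronCoord_ne_zero (ε : K) (i : Fin 12) : icosahedronCoord ε i ≠ 0 := by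
  fin_cases i <;> simp [icosahedronCoord]

/-- The vertices of a regular icosahedron inscribed in the Riemann sphere. -/
def icosahedronVertex (ε : K) (i : Fin 12) : ℙ K (Fin 2 → K) :=
  .mk K (icosahedronCoord ε i) (icosahedronCoord_ne_zero ε i)

lemma mk_smul_icosahedronVertex (ε : K) (g : GL (Fin 2) K) (i j : Fin 12)
    (h : (g 0 0 * icosahedronCoord ε i 0 + g 0 1 * icosahedronCoord ε i 1) * icosahedronCoord ε j 1
      = (g 1 0 * icosahedronCoord ε i 0 + g 1 1 * icosahedronCoord ε i 1)
        * icosahedronCoord ε j 0) :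
    (ProjGenLinGroup.mk g : PGL(2, K)) • icosahedronVertex ε i = icosahedronVertex ε j := by
  refine Projectivization.mk_eq_mk_of_mul_eq_mul _ _ ?_
  rw [← GeneralLinearGroup.smul_fin_two_apply, ← GeneralLinearGroup.smul_fin_two_apply] at h
  exact h

lemma eq_one_of_smul_icosahedronVertex {ε : K} (hε : ε ^ 4 + ε ^ 3 + ε ^ 2 + ε + 1 = 0)
    {g : PGL(2, K)} (h : ∀ i, g • icosahedronVertex ε i = icosahedronVertex ε i) : g = 1 := by
  cases g with | mk G => ?_
  have hG (i : Fin 12) := Projectivization.mul_eq_mul_of_mk_eq_mk (h i)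
  have h0 := hG 0
  have h1 := hG 1
  have h2 := hG 2
  simp [icosahedronCoord, GeneralLinearGroup.smul_fin_two_apply] at h0 h1 h2
  have hz : ε + ε ^ 4 ≠ 0 := fun hz ↦ by
    grind
  refine (ProjGenLinGroup.mk_eq_one).mpr
    (GeneralLinearGroup.mem_center_of_smul_eq (b := G 0 0) one_ne_zero ?_)
  have h3 : G 0 0 = G 1 1 := mul_right_cancel₀ hz (by
    linear_combination h2 - h1 - (ε + ε ^ 4) ^ 2 * h0)
  ext i j
  fin_cases i <;> fin_cases j <;> simp [h0.symm, h1, h3]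

theorem exists_injective_alternatingGroup_five_PGL [CharZero K] {ε : K}
    (hε : ε ^ 4 + ε ^ 3 + ε ^ 2 + ε + 1 = 0) :
    ∃ f : alternatingGroup (Fin 5) →* PGL(2, K), Function.Injective f := by
  let L := compatibleSubgroup (G := PGL(2, K)) icosahedronRotation (icosahedronVertex ε)
  have hε0 : ε ≠ 0 := by
    rintro rfl
    simp at hε
  have hs : ∃ g, (c[0, 1, 2, 3, 4], g) ∈ L := by
    have hπ (i : Fin 12) : (c[2, 3, 4, 5, 6] * c[7, 8, 9, 10, 11] : Perm (Fin 12)) i =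
      ![0, 1, 3, 4, 5, 6, 2, 8, 9, 10, 11, 7] i := by decide +kernel +revert
    have hx : ∀ i, c[0, 1, 2, 3, 4] * icosahedronRotation i = icosahedronRotation
        ((c[2, 3, 4, 5, 6] * c[7, 8, 9, 10, 11] : Perm (Fin 12)) i) * c[0, 1, 2, 3, 4] := by
      decide +kernel
    refine ⟨.mk (GeneralLinearGroup.mkOfDetNeZero !![ε, 0; 0, 1] (by simpa using hε0)),
      _, hx, fun i ↦ mk_smul_icosahedronVertex _ _ _ _ ?_⟩
    rw [hπ]
    fin_cases i <;> simp [icosahedronCoord, GeneralLinearGroup.mkOfDetNeZero] <;> grind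
  have ht : ∃ g, (c[1, 2] * c[3, 4], g) ∈ L := by
    have hπ (i : Fin 12) : (c[0, 7] * c[1, 2] * c[3, 6] * c[4, 9] * c[5, 10] * c[8, 11] :
      Perm (Fin 12)) i = ![7, 2, 1, 6, 9, 10, 3, 0, 11, 4, 5, 8] i := by decide +kernel +revert
    have hx : ∀ i, c[1, 2] * c[3, 4] * icosahedronRotation i = icosahedronRotation
        ((c[0, 7] * c[1, 2] * c[3, 6] * c[4, 9] * c[5, 10] * c[8, 11] : Perm (Fin 12)) i) *
          (c[1, 2] * c[3, 4]) := by
      decide +kernel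
    have hdet : !![ε ^ 4 - ε, ε ^ 2 - ε ^ 3; ε ^ 2 - ε ^ 3, ε - ε ^ 4].det ≠ 0 := by
      rw [Matrix.det_fin_two_of]
      grind
    refine ⟨.mk (GeneralLinearGroup.mkOfDetNeZero _ hdet), _, hx,
      fun i ↦ mk_smul_icosahedronVertex _ _ _ _ ?_⟩
    rw [hπ]
    fin_cases i <;> simp [icosahedronCoord, GeneralLinearGroup.mkOfDetNeZero] <;> grind
  refine exists_injective_of_subgroup_prod
    (a := ⟨c[1, 2] * c[3, 4], Perm.mem_alternatingGroup.mpr (by decide)⟩)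
    (L.comap (MonoidHom.prodMap (alternatingGroup (Fin 5)).subtype (MonoidHom.id _))) ?_ ?_ ?_
  · have hle : alternatingGroup (Fin 5) ≤ L.map (MonoidHom.fst _ _) :=
      alternatingGroup_five_le (by simpa using hs) (by simpa using ht)
    intro σ
    simpa using hle σ.2
  · intro g hg
    exact eq_one_of_smul_icosahedronVertex hε
      (smul_eq_of_one_mem_compatibleSubgroup icosahedronRotation_injective hg)
  · rintro ⟨π, hπ, hP⟩
    have hx : c[1, 2] * c[3, 4] * icosahedronRotation 0
        = icosahedronRotation 7 * (c[1, 2] * c[3, 4]) := by decide +kernel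
    have h7 : π 0 = 7 :=
      icosahedronRotation_injective (mul_right_cancel ((hπ 0).symm.trans hx))
    have h0 : icosahedronVertex ε 0 = icosahedronVertex ε 7 := by
      rw [← h7, ← hP 0]
      exact (one_smul _ _).symm
    simpa [icosahedronCoord] using Projectivization.mul_eq_mul_of_mk_eq_mk h0

end Embedding

/-- Lemma 1.9(1): `Aut(P¹) = PGL₂(ℂ)` contains the alternating group `A₅` but
not the symmetric group `S₅`. -/
theorem stmt_19 :
    (∃ f : alternatingGroup (Fin 5) →*
        (GL (Fin 2) ℂ ⧸ Subgroup.center (GL (Fin 2) ℂ)), Function.Injective f) ∧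
    ¬ (∃ f : Equiv.Perm (Fin 5) →*
        (GL (Fin 2) ℂ ⧸ Subgroup.center (GL (Fin 2) ℂ)), Function.Injective f) := by
  refine ⟨?_, fun ⟨f, hf⟩ ↦ not_injective_perm_five_PGL (K := ℂ) f hf⟩
  obtain ⟨ε, hε⟩ := IsAlgClosed.exists_root (Polynomial.cyclotomic 5 ℂ)
    (Polynomial.degree_cyclotomic_pos 5 ℂ (by norm_num)).ne'
  refine exists_injective_alternatingGroup_five_PGL (K := ℂ) (ε := ε) ?_
  have : Fact (Nat.Prime 5) := ⟨Nat.prime_five⟩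
  rw [Polynomial.IsRoot, Polynomial.cyclotomic_prime, Polynomial.eval_geom_sum] at hε
  simp only [Finset.sum_range_succ, Finset.sum_range_zero] at hε
  linear_combination hε
end
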